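/- For every digit rewriting system, the associated category F is right-Ore (cancellative with common right multiples) and has no non-trivial invertible morphisms. -/

import Mathlib

open CategoryTheory

universe v u

namespace OreOrder

/-- A group is bi-orderable if it admits a linear order invariant under left and right
multiplication. -/
def IsBiOrderable (G : Type*) [Group G] : Prop :=
  ∃ lt : G → G → Prop,
    (∀ a, ¬ lt a a) ∧ (∀ a b c, lt a b → lt b c → lt a c) ∧
    (∀ a b, a ≠ b → lt a b ∨ lt b a) ∧
    (∀ a b c, lt b c → lt (a * b) (a * c)) ∧
    (∀ a b c, lt b c → lt (b * a) (c * a))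

/-- A category is right-Ore if it is cancellative and has common right multiples. -/
structure IsRightOre (C : Type u) [Category.{v} C] : Prop where
  cancel_left : ∀ {x y z : C} (a : x ⟶ y) (b c : y ⟶ z), a ≫ b = a ≫ c → b = c
  cancel_right : ∀ {x y z : C} (a b : x ⟶ y) (c : y ⟶ z), a ≫ c = b ≫ c → a = b
  common_right_mul : ∀ {x y₁ y₂ : C} (a₁ : x ⟶ y₁) (a₂ : x ⟶ y₂),
    ∃ (z : C) (b₁ : y₁ ⟶ z) (b₂ : y₂ ⟶ z), a₁ ≫ b₁ = a₂ ≫ b₂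

/-- The fundamental group of a category `C` based at an object `ε`: the vertex group at `ε`
of the enveloping groupoid of `C`, i.e. of the localization of `C` at all of its morphisms. -/
abbrev FundGroup (C : Type u) [Category.{v} C] (ε : C) :=
  Aut ((⊤ : MorphismProperty C).Q.obj ε)

/-- A digit rewriting system (DRS) over an alphabet `A`: a set of rewriting rules
`x ← u₁ ⋯ u_k` (`k ≥ 2`), with at most one rule for each letter `x`. -/
structure DRS (A : Type u) where
  rule : A → Option (List A)
  two_le_length : ∀ x u, rule x = some u → 2 ≤ u.length

/-- The objects of the category of a DRS: the finite words over the alphabet. -/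
structure DRSObj {A : Type u} (R : DRS A) where
  word : List A

/-- The elementary rewritings `w₁ x w₂ ← w₁ u₁ ⋯ u_k w₂` of a DRS. -/
inductive DRSEdge {A : Type u} (R : DRS A) : List A → List A → Type u
  | rewrite (w₁ w₂ : List A) (x : A) (u : List A) (hu : R.rule x = some u)
      {a b : List A} (ha : a = w₁ ++ x :: w₂) (hb : b = w₁ ++ u ++ w₂) : DRSEdge R a b

instance {A : Type u} (R : DRS A) : Quiver (DRSObj R) :=
  ⟨fun v w => DRSEdge R v.word w.word⟩

/-- A single elementary rewriting, as a morphism of the path category. -/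
def singleRewrite {A : Type u} (R : DRS A) (w₁ w₂ : List A) (x : A) (u : List A)
    (hu : R.rule x = some u) (a b : List A)
    (ha : a = w₁ ++ x :: w₂) (hb : b = w₁ ++ u ++ w₂) :
    Quiver.Path (⟨a⟩ : DRSObj R) (⟨b⟩ : DRSObj R) :=
  Quiver.Hom.toPath
    (show (⟨a⟩ : DRSObj R) ⟶ (⟨b⟩ : DRSObj R) from DRSEdge.rewrite w₁ w₂ x u hu ha hb)

/-- The relations of the category of a DRS: two rewritings performed on disjoint subwords
commute. -/
inductive DRSRel {A : Type u} (R : DRS A) : HomRel (Paths (DRSObj R))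
  | comm (w₁ w₂ w₃ : List A) (x₁ x₂ : A) (u₁ u₂ : List A)
      (h₁ : R.rule x₁ = some u₁) (h₂ : R.rule x₂ = some u₂) :
      DRSRel R
        (singleRewrite R w₁ (w₂ ++ x₂ :: w₃) x₁ u₁ h₁
            (w₁ ++ x₁ :: (w₂ ++ x₂ :: w₃)) (w₁ ++ u₁ ++ (w₂ ++ x₂ :: w₃)) rfl rfl |>.comp <|
          singleRewrite R (w₁ ++ u₁ ++ w₂) w₃ x₂ u₂ h₂
            (w₁ ++ u₁ ++ (w₂ ++ x₂ :: w₃)) (w₁ ++ u₁ ++ (w₂ ++ u₂ ++ w₃))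
            (by simp) (by simp))
        (singleRewrite R (w₁ ++ x₁ :: w₂) w₃ x₂ u₂ h₂
            (w₁ ++ x₁ :: (w₂ ++ x₂ :: w₃)) (w₁ ++ x₁ :: (w₂ ++ u₂ ++ w₃))
            (by simp) (by simp) |>.comp <|
          singleRewrite R w₁ (w₂ ++ u₂ ++ w₃) x₁ u₁ h₁
            (w₁ ++ x₁ :: (w₂ ++ u₂ ++ w₃)) (w₁ ++ u₁ ++ (w₂ ++ u₂ ++ w₃)) rfl rfl)

/-- The category `F` associated to a digit rewriting system `R`. -/
abbrev DRSCat {A : Type u} (R : DRS A) := CategoryTheory.Quotient (DRSRel R)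

/-- The object of `DRSCat R` corresponding to a word `w`. -/
abbrev DRSCat.ofWord {A : Type u} (R : DRS A) (w : List A) : DRSCat R := ⟨⟨w⟩⟩



variable {A : Type u} {R : DRS A}

/-! ### Words of Booleans: replacing the `i`-th `false` by `true false^k` -/

/-- Replace the `i`-th `false` by a `true` followed by `k` copies of `false`. -/
def ins (i k : ℕ) : List Bool → List Bool
  | [] => []
  | true :: b => true :: ins i k b
  | false :: b =>
    match i with
    | 0 => true :: (List.replicate k false ++ b)
    | j + 1 => false :: ins j k b

lemma ins_replicate (n j k : ℕ) (b : List Bool) :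
    ins (n + j) k (List.replicate n false ++ b) = List.replicate n false ++ ins j k b := by
  induction n with
  | zero => simp
  | succ n ih =>
    rw [show n + 1 + j = (n + j) + 1 by omega, List.replicate_succ]
    simp [ins, ih]

lemma ins_comm (i j k l : ℕ) (b : List Bool) :
    ins (i + k + j) l (ins i k b) = ins i k (ins (i + 1 + j) l b) := by
  induction b generalizing i with
  | nil => simp [ins]
  | cons c b ih =>
    cases c with
    | true => simp [ins, ih]
    | false =>
      cases i with
      | zero =>
        rw [show 0 + 1 + j = j + 1 by omega]
        simp [ins, ins_replicate]
      | succ i =>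
        rw [show i + 1 + k + j = (i + k + j) + 1 by omega,
          show i + 1 + 1 + j = (i + 1 + j) + 1 by omega]
        simp [ins, ih]

lemma ins_inj (i k : ℕ) (hk : 1 ≤ k) (b c : List Bool) (h : ins i k b = ins i k c) : b = c := by
  obtain ⟨k, rfl⟩ : ∃ m, k = m + 1 := ⟨k - 1, by omega⟩
  have key : ∀ (b l : List Bool), ins 0 (k + 1) b ≠ false :: l := by
    intro b l
    match b with
    | [] => simp [ins]
    | true :: b => simp [ins]
    | false :: b => simp [ins]
  induction b generalizing i c with
  | nil =>
    match c, i with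
    | [], _ => rfl
    | true :: c, _ => simp [ins] at h
    | false :: c, 0 => simp [ins] at h
    | false :: c, i + 1 => simp [ins] at h
  | cons d b ih =>
    match d, c, i with
    | true, [], _ => simp [ins] at h
    | false, [], 0 => simp [ins] at h
    | false, [], i + 1 => simp [ins] at h
    | true, true :: c, i => rw [ih i c (by simpa [ins] using h)]
    | false, false :: c, 0 => simpa [ins] using h
    | false, false :: c, i + 1 => rw [ih i c (by simpa [ins] using h)]
    | true, false :: c, 0 =>
      simp only [ins, List.cons.injEq, true_and, List.replicate_succ, List.cons_append] at h
      exact absurd h (key _ _)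
    | false, true :: c, 0 =>
      simp only [ins, List.cons.injEq, true_and, List.replicate_succ, List.cons_append] at h
      exact absurd h.symm (key _ _)
    | true, false :: c, i + 1 => simp [ins] at h
    | false, true :: c, i + 1 => simp [ins] at h

/-! ### Interface to the category -/

/-- The elementary morphism. -/
def E (R : DRS A) (w₁ w₂ : List A) (x : A) (u : List A)
    (hu : R.rule x = some u) (a b : List A)
    (ha : a = w₁ ++ x :: w₂) (hb : b = w₁ ++ u ++ w₂) :
    DRSCat.ofWord R a ⟶ DRSCat.ofWord R b :=
  (Quotient.functor (DRSRel R)).map (singleRewrite R w₁ w₂ x u hu a b ha hb)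

lemma mor_induction (P : ∀ (a b : List A), (DRSCat.ofWord R a ⟶ DRSCat.ofWord R b) → Prop)
    (hid : ∀ a, P a a (𝟙 _))
    (hcomp : ∀ (a b : List A) (p : DRSCat.ofWord R a ⟶ DRSCat.ofWord R b) (w₁ w₂ x u hu c hb hc),
      P a b p → P a c (p ≫ E R w₁ w₂ x u hu b c hb hc))
    (a b : List A) (p : DRSCat.ofWord R a ⟶ DRSCat.ofWord R b) : P a b p := by
  obtain ⟨p⟩ := p
  change Quiver.Path (⟨a⟩ : DRSObj R) ⟨b⟩ at p
  have : ∀ (y : DRSObj R) (p : Quiver.Path (⟨a⟩ : DRSObj R) y), P a y.word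
      ((Quotient.functor (DRSRel R)).map p) := by
    intro y p
    induction p with
    | nil => exact hid a
    | cons p e ih =>
      obtain ⟨w₁, w₂, x, u, hu, ha, hb⟩ := e
      exact hcomp _ _ _ w₁ w₂ x u hu _ ha hb ih
  exact this _ p

lemma E_comm (w₁ w₂ w₃ : List A) (x₁ x₂ : A) (u₁ u₂ : List A)
    (h₁ : R.rule x₁ = some u₁) (h₂ : R.rule x₂ = some u₂) (a b c d : List A)
    (ha : a = w₁ ++ x₁ :: (w₂ ++ x₂ :: w₃)) (hb : b = w₁ ++ u₁ ++ (w₂ ++ x₂ :: w₃))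
    (hc : c = w₁ ++ x₁ :: (w₂ ++ u₂ ++ w₃)) (hd : d = w₁ ++ u₁ ++ (w₂ ++ u₂ ++ w₃)) :
    E R w₁ (w₂ ++ x₂ :: w₃) x₁ u₁ h₁ a b ha hb ≫
      E R (w₁ ++ u₁ ++ w₂) w₃ x₂ u₂ h₂ b d (by simp [hb]) (by simp [hd]) =
    E R (w₁ ++ x₁ :: w₂) w₃ x₂ u₂ h₂ a c (by simp [ha]) (by simp [hc]) ≫
      E R w₁ (w₂ ++ u₂ ++ w₃) x₁ u₁ h₁ c d hc hd := by
  subst ha hb hc hd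
  exact CategoryTheory.Quotient.sound _ (DRSRel.comm w₁ w₂ w₃ x₁ x₂ u₁ u₂ h₁ h₂)

/-- Action of an edge on Boolean words. -/
def actE {a b : List A} : DRSEdge R a b → List Bool → List Bool
  | .rewrite w₁ _ _ u _ _ _ => ins w₁.length u.length

/-- Action of a path on Boolean words. -/
def actP {a : DRSObj R} : {b : DRSObj R} → Quiver.Path a b → List Bool → List Bool
  | _, .nil => id
  | _, .cons p e => fun l => actE e (actP p l)

lemma actP_comp {a b c : DRSObj R} (p : Quiver.Path a b) (q : Quiver.Path b c) (l : List Bool) :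
    actP (p.comp q) l = actP q (actP p l) := by
  induction q with
  | nil => rfl
  | cons q e ih => 
    rw [Quiver.Path.comp_cons]
    simp only [actP, ih]

lemma actP_rel {s t : Paths (DRSObj R)} (m₁ m₂ : s ⟶ t) (h : DRSRel R m₁ m₂) (l : List Bool) :
    actP (R := R) m₁ l = actP (R := R) m₂ l := by
  obtain ⟨w₁, w₂, w₃, x₁, x₂, u₁, u₂, h₁, h₂⟩ := h
  refine (actP_comp _ _ _).trans (Eq.trans ?_ (actP_comp _ _ _).symm)
  have := ins_comm w₁.length w₂.length u₁.length u₂.length l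
  simpa [singleRewrite, actP, actE, Quiver.Hom.toPath, add_assoc, add_comm 1] using this

/-- Action of a morphism on Boolean words. -/
def act {a b : DRSCat R} (f : a ⟶ b) : List Bool → List Bool :=
  Quot.lift (fun p => actP (R := R) p) (by
    rintro _ _ ⟨s, t, f, m₁, m₂, g, h⟩
    funext l
    have key : ∀ m : s ⟶ t, actP (R := R) (f ≫ m ≫ g) l =
        actP (R := R) g (actP (R := R) m (actP (R := R) f l)) := fun m =>
      (actP_comp (R := R) f (m ≫ g) l).trans (actP_comp (R := R) m g _)
    exact (key m₁).trans ((congrArg _ (actP_rel m₁ m₂ h _)).trans (key m₂).symm)) f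

lemma act_id (a : DRSCat R) (l : List Bool) : act (𝟙 a) l = l := rfl

lemma act_comp {a b c : DRSCat R} (f : a ⟶ b) (g : b ⟶ c) (l : List Bool) :
    act (f ≫ g) l = act g (act f l) := by
  obtain ⟨f⟩ := f
  obtain ⟨g⟩ := g
  exact actP_comp f g l

lemma act_E (w₁ w₂ : List A) (x : A) (u : List A) (hu : R.rule x = some u) (a b : List A)
    (ha : a = w₁ ++ x :: w₂) (hb : b = w₁ ++ u ++ w₂) (l : List Bool) :
    act (E R w₁ w₂ x u hu a b ha hb) l = ins w₁.length u.length l := rfl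

/-- The code of a morphism. -/
def code {a b : List A} (f : DRSCat.ofWord R a ⟶ DRSCat.ofWord R b) : List Bool :=
  act f (List.replicate a.length false)

lemma code_id (a : List A) : code (𝟙 (DRSCat.ofWord R a)) = List.replicate a.length false := rfl

lemma code_comp_E {c a b : List A} (f : DRSCat.ofWord R c ⟶ DRSCat.ofWord R a)
    (w₁ w₂ : List A) (x : A) (u : List A) (hu : R.rule x = some u)
    (ha : a = w₁ ++ x :: w₂) (hb : b = w₁ ++ u ++ w₂) :
    code (f ≫ E R w₁ w₂ x u hu a b ha hb) = ins w₁.length u.length (code f) := by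
  unfold code
  rw [act_comp, act_E]

/-- Whiskering by a letter, on the quiver. -/
def whiskQ (R : DRS A) (y : A) : DRSObj R ⥤q DRSCat R where
  obj w := DRSCat.ofWord R (y :: w.word)
  map {a b} e := match (show DRSEdge R a.word b.word from e) with
    | .rewrite w₁ w₂ x u hu ha hb =>
      E R (y :: w₁) w₂ x u hu (y :: a.word) (y :: b.word) (by simp [ha]) (by simp [hb])

/-- Whiskering by a letter. -/
def whisk (R : DRS A) (y : A) : DRSCat R ⥤ DRSCat R :=
  CategoryTheory.Quotient.lift _ (Paths.lift (whiskQ R y)) (by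
    rintro _ _ _ _ ⟨w₁, w₂, w₃, x₁, x₂, u₁, u₂, h₁, h₂⟩
    have := E_comm (R := R) (y :: w₁) w₂ w₃ x₁ x₂ u₁ u₂ h₁ h₂ _ _ _ _ rfl rfl rfl rfl
    have h1 : ∀ {a b c : DRSObj R} (p : Quiver.Path a b) (q : Quiver.Path b c),
      (Paths.lift (whiskQ R y)).map (p.comp q) =
        (Paths.lift (whiskQ R y)).map p ≫ (Paths.lift (whiskQ R y)).map q :=
      fun p q => (Paths.lift (whiskQ R y)).map_comp p q
    rw [h1, h1]
    unfold singleRewrite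
    rw [Paths.lift_toPath, Paths.lift_toPath, Paths.lift_toPath, Paths.lift_toPath]
    exact this)

/-- Whiskering of a morphism between words. -/
def wh (y : A) {a b : List A} (f : DRSCat.ofWord R a ⟶ DRSCat.ofWord R b) :
    DRSCat.ofWord R (y :: a) ⟶ DRSCat.ofWord R (y :: b) := (whisk R y).map f

lemma wh_id (y : A) (a : List A) : wh y (𝟙 (DRSCat.ofWord R a)) = 𝟙 _ := (whisk R y).map_id _

lemma wh_comp (y : A) {a b c : List A} (f : DRSCat.ofWord R a ⟶ DRSCat.ofWord R b)
    (g : DRSCat.ofWord R b ⟶ DRSCat.ofWord R c) : wh y (f ≫ g) = wh y f ≫ wh y g :=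
  (whisk R y).map_comp _ _

lemma wh_E (y : A) (w₁ w₂ : List A) (x : A) (u : List A) (hu : R.rule x = some u) (a b : List A)
    (ha : a = w₁ ++ x :: w₂) (hb : b = w₁ ++ u ++ w₂) :
    wh y (E R w₁ w₂ x u hu a b ha hb) =
      E R (y :: w₁) w₂ x u hu (y :: a) (y :: b) (by simp [ha]) (by simp [hb]) :=
  Paths.lift_toPath _ _

lemma code_wh (y : A) (a b : List A) (f : DRSCat.ofWord R a ⟶ DRSCat.ofWord R b) :
    code (wh y f) = false :: code f := by
  refine mor_induction (fun a b f => code (wh y f) = false :: code f) ?_ ?_ a b f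
  · intro a
    rw [wh_id, code_id, code_id]
    rfl
  · intro a b p w₁ w₂ x u hu c hb hc ih
    rw [wh_comp, wh_E, code_comp_E, code_comp_E, ih]
    rfl

lemma code_E_comp (w : List A) (x : A) (u : List A) (hu : R.rule x = some u) (b v : List A)
    (hb : b = u ++ w) (f : DRSCat.ofWord R b ⟶ DRSCat.ofWord R v) :
    code (E R [] w x u hu (x :: w) b rfl hb ≫ f) = true :: code f := by
  revert hb
  refine mor_induction (fun b v f => ∀ hb, code (E R [] w x u hu (x :: w) b rfl hb ≫ f) =
    true :: code f) ?_ ?_ b v f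
  · rintro _ rfl
    unfold code
    rw [act_comp, act_E, act_id]
    simp [ins, List.replicate_succ]
    rfl
  · intro a b p w₁ w₂ x u hu c hb hc ih h
    rw [← Category.assoc, code_comp_E, code_comp_E, ih]
    rfl

/-! ### Normal forms (leftmost derivations) -/

/-- Leftmost derivations. -/
inductive NF (R : DRS A) : List A → List A → Type u
  | nil : NF R [] []
  | leaf (x : A) {w v : List A} (f : NF R w v) : NF R (x :: w) (x :: v)
  | node (x : A) (u : List A) (hu : R.rule x = some u) {w v : List A} (f : NF R (u ++ w) v) :
      NF R (x :: w) v

/-- The morphism of a leftmost derivation. -/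
def NF.mor : {w v : List A} → NF R w v → (DRSCat.ofWord R w ⟶ DRSCat.ofWord R v)
  | _, _, .nil => 𝟙 _
  | _, _, .leaf x f => wh x f.mor
  | _, _, .node (w := w) x u hu f => E R [] w x u hu (x :: w) (u ++ w) rfl rfl ≫ f.mor

/-- The code of a leftmost derivation. -/
def NF.bits : {w v : List A} → NF R w v → List Bool
  | _, _, .nil => []
  | _, _, .leaf _ f => false :: f.bits
  | _, _, .node _ _ _ f => true :: f.bits

lemma NF.code_mor {w v : List A} (f : NF R w v) : code f.mor = f.bits := by
  induction f with
  | nil => rfl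
  | leaf x f ih => rw [NF.mor, NF.bits, code_wh, ih]
  | node x u hu f ih => rw [NF.mor, NF.bits, code_E_comp, ih]

lemma NF.bits_inj {w v : List A} (f g : NF R w v) (h : f.bits = g.bits) : f = g := by
  induction f with
  | nil => cases g; rfl
  | leaf x f ih =>
    cases g with
    | leaf _ g => rw [ih g (by simpa [NF.bits] using h)]
    | node _ u hu g => simp [NF.bits] at h
  | node x u hu f ih =>
    cases g with
    | leaf _ g => simp [NF.bits] at h
    | node _ u' hu' g =>
      obtain rfl : u = u' := by simpa [hu] using hu'
      rw [ih g (by simpa [NF.bits] using h)]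

/-- The identity derivation. -/
def NF.one (R : DRS A) : (w : List A) → NF R w w
  | [] => .nil
  | x :: w => .leaf x (NF.one R w)

lemma NF.one_mor (w : List A) : (NF.one R w).mor = 𝟙 _ := by
  induction w with
  | nil => rfl
  | cons x w ih => rw [NF.one, NF.mor, ih, wh_id]

/-- Complete codes. -/
inductive Cpl (R : DRS A) : List A → List Bool → Prop
  | nil : Cpl R [] []
  | leaf (x : A) {w : List A} {b : List Bool} (f : Cpl R w b) : Cpl R (x :: w) (false :: b)
  | node (x : A) (u : List A) (hu : R.rule x = some u) {w : List A} {b : List Bool}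
      (f : Cpl R (u ++ w) b) : Cpl R (x :: w) (true :: b)

lemma Cpl.prefix_free {w : List A} {b c : List Bool} (hb : Cpl R w b) (hc : Cpl R w c)
    (b' c' : List Bool) (h : b ++ b' = c ++ c') : b = c := by
  induction hb generalizing c with
  | nil => cases hc; rfl
  | leaf x f ih =>
    cases hc with
    | leaf _ g => rw [ih g (by simpa using h)]
    | node _ u hu g => simp at h
  | node x u hu f ih =>
    cases hc with
    | leaf _ g => simp at h
    | node _ u' hu' g =>
      obtain rfl : u = u' := by simpa [hu] using hu'
      rw [ih g (by simpa using h)]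

lemma NF.pre {W v : List A} (f : NF R W v) (w₁ w₂ : List A) (x : A) (u : List A)
    (hu : R.rule x = some u) (a : List A) (ha : a = w₁ ++ x :: w₂) (hW : W = w₁ ++ u ++ w₂) :
    ∃ (g : NF R a v) (b c : List Bool), E R w₁ w₂ x u hu a W ha hW ≫ f.mor = g.mor ∧
      Cpl R w₁ b ∧ f.bits = b ++ c ∧ g.bits = b ++ true :: c := by
  induction f generalizing w₁ a with
  | nil =>
    have := R.two_le_length _ _ hu
    have h2 := congrArg List.length hW
    simp at h2
    omega
  | @leaf y w v f ih =>
    cases w₁ with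
    | nil =>
      subst ha
      have hW' : y :: w = u ++ w₂ := hW
      generalize hF : NF.leaf y f = F
      clear hF ih
      revert F
      generalize y :: v = v'
      revert hW
      rw [hW']
      intro hW F
      exact ⟨.node x u hu F, [], F.bits, rfl, .nil, rfl, rfl⟩
    | cons z w₁ =>
      simp only [List.cons_append, List.cons.injEq] at hW
      obtain ⟨rfl, rfl⟩ := hW
      subst ha
      obtain ⟨g, b, c, h1, h2, h3, h4⟩ := ih w₁ _ rfl rfl
      refine ⟨.leaf y g, false :: b, c, ?_, .leaf y h2, by simp [NF.bits, h3],
        by simp [NF.bits, h4]⟩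
      rw [NF.mor, NF.mor, ← h1, wh_comp]
      exact congrArg (· ≫ wh y f.mor) (wh_E y w₁ w₂ x u hu _ _ rfl rfl).symm
  | @node y t ht w v f ih =>
    cases w₁ with
    | nil =>
      subst ha
      have hW' : y :: w = u ++ w₂ := hW
      generalize hF : NF.node y t ht f = F
      clear hF ih
      revert F
      revert hW
      rw [hW']
      intro hW F
      exact ⟨.node x u hu F, [], F.bits, rfl, .nil, rfl, rfl⟩
    | cons z w₁ =>
      simp only [List.cons_append, List.cons.injEq] at hW
      obtain ⟨rfl, rfl⟩ := hW
      subst ha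
      obtain ⟨g, b, c, h1, h2, h3, h4⟩ := ih (t ++ w₁) (t ++ (w₁ ++ x :: w₂)) (by simp) (by simp)
      refine ⟨.node y t ht g, true :: b, c, ?_, .node y t ht h2, by simp [NF.bits, h3],
        by simp [NF.bits, h4]⟩
      rw [NF.mor, NF.mor, ← h1, ← Category.assoc, ← Category.assoc]
      congr 1
      exact (E_comm [] w₁ w₂ y x t u ht hu _ _ _ _ rfl rfl (by simp) (by simp)).symm

lemma comp_NF (a b : List A) (p : DRSCat.ofWord R a ⟶ DRSCat.ofWord R b) (v : List A)
    (f : NF R b v) : ∃ g : NF R a v, p ≫ f.mor = g.mor := by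
  revert v f
  refine mor_induction (fun a b p => ∀ v, ∀ f : NF R b v, ∃ g : NF R a v, p ≫ f.mor = g.mor)
    ?_ ?_ a b p
  · intro a v f
    exact ⟨f, Category.id_comp _⟩
  · intro a b p w₁ w₂ x u hu c hb hc ih v f
    obtain ⟨g, _, _, h, _⟩ := f.pre w₁ w₂ x u hu b hb hc
    rw [Category.assoc, h]
    exact ih v g

lemma exists_NF {a b : List A} (p : DRSCat.ofWord R a ⟶ DRSCat.ofWord R b) :
    ∃ g : NF R a b, p = g.mor := by
  obtain ⟨g, hg⟩ := comp_NF a b p b (NF.one R b)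
  rw [NF.one_mor, Category.comp_id] at hg
  exact ⟨g, hg⟩

lemma code_inj {a b : List A} (p q : DRSCat.ofWord R a ⟶ DRSCat.ofWord R b)
    (h : code p = code q) : p = q := by
  obtain ⟨f, rfl⟩ := exists_NF p
  obtain ⟨g, rfl⟩ := exists_NF q
  rw [NF.code_mor, NF.code_mor] at h
  rw [NF.bits_inj f g h]

lemma E_cancel_left {a b v : List A} (w₁ w₂ : List A) (x : A) (u : List A)
    (hu : R.rule x = some u) (ha : a = w₁ ++ x :: w₂) (hb : b = w₁ ++ u ++ w₂)
    (p q : DRSCat.ofWord R b ⟶ DRSCat.ofWord R v)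
    (h : E R w₁ w₂ x u hu a b ha hb ≫ p = E R w₁ w₂ x u hu a b ha hb ≫ q) : p = q := by
  obtain ⟨f, rfl⟩ := exists_NF p
  obtain ⟨g, rfl⟩ := exists_NF q
  obtain ⟨f', b₁, c₁, h1, h2, h3, h4⟩ := f.pre w₁ w₂ x u hu a ha hb
  obtain ⟨g', b₂, c₂, k1, k2, k3, k4⟩ := g.pre w₁ w₂ x u hu a ha hb
  rw [h1, k1] at h
  have e := congrArg code h
  rw [NF.code_mor, NF.code_mor, h4, k4] at e
  obtain rfl := h2.prefix_free k2 _ _ e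
  have : c₁ = c₂ := by simpa using e
  rw [NF.bits_inj f g (by rw [h3, k3, this])]

/-! ### Common multiples -/

/-- Identities and elementary morphisms. -/
inductive Elem (R : DRS A) : ∀ (a b : List A), (DRSCat.ofWord R a ⟶ DRSCat.ofWord R b) → Prop
  | one (a : List A) : Elem R a a (𝟙 _)
  | edge (w₁ w₂ x u hu a b ha hb) : Elem R a b (E R w₁ w₂ x u hu a b ha hb)

lemma diamond_edge (w₁ w₂ x u hu a b ha hb) (w₁' w₂' x' u' hu' b' ha' hb') :
    ∃ (c : List A) (p : DRSCat.ofWord R b ⟶ DRSCat.ofWord R c)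
      (q : DRSCat.ofWord R b' ⟶ DRSCat.ofWord R c), Elem R b c p ∧ Elem R b' c q ∧
      E R w₁ w₂ x u hu a b ha hb ≫ p = E R w₁' w₂' x' u' hu' a b' ha' hb' ≫ q := by
  subst hb hb'
  have h := ha.symm.trans ha'
  rw [List.append_eq_append_iff] at h
  rcases h with ⟨t, h1, h2⟩ | ⟨t, h1, h2⟩
  · cases t with
    | nil =>
      simp only [List.append_nil, List.nil_append, List.cons.injEq] at h1 h2
      obtain ⟨rfl, rfl⟩ := h2
      subst h1
      obtain rfl : u = u' := by simpa [hu] using hu'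
      exact ⟨_, 𝟙 _, 𝟙 _, .one _, .one _, rfl⟩
    | cons y t =>
      simp only [List.cons_append, List.cons.injEq] at h2
      obtain ⟨rfl, rfl⟩ := h2
      subst h1
      exact ⟨_, _, _, .edge _ _ _ _ _ _ _ _ _, .edge _ _ _ _ _ _ _ _ _,
        E_comm w₁ t w₂' x x' u u' hu hu' _ _ _ _ ha rfl (by simp) rfl⟩
  · cases t with
    | nil =>
      simp only [List.append_nil, List.nil_append, List.cons.injEq] at h1 h2
      obtain ⟨rfl, rfl⟩ := h2
      subst h1
      obtain rfl : u = u' := by simpa [hu] using hu'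
      exact ⟨_, 𝟙 _, 𝟙 _, .one _, .one _, rfl⟩
    | cons y t =>
      simp only [List.cons_append, List.cons.injEq] at h2
      obtain ⟨rfl, rfl⟩ := h2
      subst h1
      exact ⟨_, _, _, .edge _ _ _ _ _ _ _ _ _, .edge _ _ _ _ _ _ _ _ _,
        (E_comm w₁' t w₂ x' x u' u hu' hu _ _ _ _ ha' rfl (by simp) rfl).symm⟩

lemma strip (a b : List A) (p : DRSCat.ofWord R a ⟶ DRSCat.ofWord R b) (b' : List A)
    (e : DRSCat.ofWord R a ⟶ DRSCat.ofWord R b') (he : Elem R a b' e) :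
    ∃ (c : List A) (e' : DRSCat.ofWord R b ⟶ DRSCat.ofWord R c)
      (q : DRSCat.ofWord R b' ⟶ DRSCat.ofWord R c), Elem R b c e' ∧ p ≫ e' = e ≫ q := by
  revert b' e he
  refine mor_induction (fun a b p => ∀ b', ∀ e : DRSCat.ofWord R a ⟶ DRSCat.ofWord R b',
    ∀ he : Elem R a b' e, ∃ (c : List A) (e' : DRSCat.ofWord R b ⟶ DRSCat.ofWord R c)
      (q : DRSCat.ofWord R b' ⟶ DRSCat.ofWord R c), Elem R b c e' ∧ p ≫ e' = e ≫ q) ?_ ?_ a b p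
  · intro a b' e he
    exact ⟨b', e, 𝟙 _, he, by rw [Category.id_comp, Category.comp_id]⟩
  · intro a b p w₁ w₂ x u hu c hb hc ih b' e he
    obtain ⟨d, e', q, he', h⟩ := ih b' e he
    cases he' with
    | one => exact ⟨c, 𝟙 _, q ≫ E R w₁ w₂ x u hu b c hb hc, .one _, by
        rw [Category.comp_id, ← Category.assoc, ← h, Category.comp_id]⟩
    | edge w₁' w₂' x' u' hu' _ _ ha' hb' =>
      obtain ⟨z, r, s, hr, hs, hrs⟩ :=
        diamond_edge (R := R) w₁ w₂ x u hu b c hb hc w₁' w₂' x' u' hu' d ha' hb'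
      exact ⟨z, r, q ≫ s, hr, by
        rw [Category.assoc, hrs, ← Category.assoc, h, Category.assoc]⟩

lemma common (a b : List A) (p : DRSCat.ofWord R a ⟶ DRSCat.ofWord R b) (b' : List A)
    (e : DRSCat.ofWord R a ⟶ DRSCat.ofWord R b') :
    ∃ (c : List A) (e' : DRSCat.ofWord R b ⟶ DRSCat.ofWord R c)
      (q : DRSCat.ofWord R b' ⟶ DRSCat.ofWord R c), p ≫ e' = e ≫ q := by
  revert b' e
  refine mor_induction (fun a b p => ∀ b', ∀ e : DRSCat.ofWord R a ⟶ DRSCat.ofWord R b',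
    ∃ (c : List A) (e' : DRSCat.ofWord R b ⟶ DRSCat.ofWord R c)
      (q : DRSCat.ofWord R b' ⟶ DRSCat.ofWord R c), p ≫ e' = e ≫ q) ?_ ?_ a b p
  · intro a b' e
    exact ⟨b', e, 𝟙 _, by rw [Category.id_comp, Category.comp_id]⟩
  · intro a b p w₁ w₂ x u hu c hb hc ih b' e
    obtain ⟨d, e', q, h⟩ := ih b' e
    obtain ⟨z, r, s, -, hrs⟩ := strip b d e' c _ (Elem.edge (R := R) w₁ w₂ x u hu b c hb hc)
    exact ⟨z, s, q ≫ r, by rw [Category.assoc, ← hrs, ← Category.assoc, h, Category.assoc]⟩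

lemma cancel_left_aux (a b : List A) (p : DRSCat.ofWord R a ⟶ DRSCat.ofWord R b) (v : List A)
    (f g : DRSCat.ofWord R b ⟶ DRSCat.ofWord R v) (h : p ≫ f = p ≫ g) : f = g := by
  revert v f g h
  refine mor_induction (fun a b p => ∀ v, ∀ f g : DRSCat.ofWord R b ⟶ DRSCat.ofWord R v,
    p ≫ f = p ≫ g → f = g) ?_ ?_ a b p
  · intro a v f g h
    rwa [Category.id_comp, Category.id_comp] at h
  · intro a b p w₁ w₂ x u hu c hb hc ih v f g h
    rw [Category.assoc, Category.assoc] at h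
    exact E_cancel_left _ _ _ _ _ _ _ _ _ (ih _ _ _ h)

lemma cancel_right_aux (a b : List A) (p : DRSCat.ofWord R a ⟶ DRSCat.ofWord R b) (v : List A)
    (f g : DRSCat.ofWord R v ⟶ DRSCat.ofWord R a) (h : f ≫ p = g ≫ p) : f = g := by
  revert v f g h
  refine mor_induction (fun a b p => ∀ v, ∀ f g : DRSCat.ofWord R v ⟶ DRSCat.ofWord R a,
    f ≫ p = g ≫ p → f = g) ?_ ?_ a b p
  · intro a v f g h
    rwa [Category.comp_id, Category.comp_id] at h
  · intro a b p w₁ w₂ x u hu c hb hc ih v f g h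
    rw [← Category.assoc, ← Category.assoc] at h
    have e := congrArg code h
    rw [code_comp_E, code_comp_E] at e
    have := R.two_le_length _ _ hu
    exact ih _ _ _ (code_inj _ _ (ins_inj _ _ (by omega) _ _ e))

lemma eq_or_lt (a b : List A) (p : DRSCat.ofWord R a ⟶ DRSCat.ofWord R b) :
    (∃ h : a = b, p = eqToHom (by rw [h])) ∨ a.length < b.length := by
  refine mor_induction (fun a b p => (∃ h : a = b, p = eqToHom (by rw [h])) ∨
    a.length < b.length) ?_ ?_ a b p
  · intro a
    exact Or.inl ⟨rfl, rfl⟩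
  · intro a b p w₁ w₂ x u hu c hb hc ih
    right
    have h2 := R.two_le_length _ _ hu
    have : b.length < c.length := by
      subst hb hc
      simp
      omega
    rcases ih with ⟨rfl, -⟩ | h
    · exact this
    · omega

/-- **The category of a DRS is right-Ore with no non-trivial invertibles.**
For every digit rewriting system, the associated category `F` is right-Ore (cancellative with
common right multiples) and has no non-trivial invertible morphisms (every invertible morphism
is an identity). -/
theorem drsCat_rightOre_and_noNontrivialInvertibles {A : Type u} (R : DRS A) :
    IsRightOre (DRSCat R) ∧
      ∀ {a b : DRSCat R} (f : a ⟶ b), IsIso f → ∃ h : a = b, f = eqToHom h := by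
  refine ⟨⟨?_, ?_, ?_⟩, ?_⟩
  · rintro ⟨⟨x⟩⟩ ⟨⟨y⟩⟩ ⟨⟨z⟩⟩ a b c h
    exact cancel_left_aux x y a z b c h
  · rintro ⟨⟨x⟩⟩ ⟨⟨y⟩⟩ ⟨⟨z⟩⟩ a b c h
    exact cancel_right_aux y z c x a b h
  · rintro ⟨⟨x⟩⟩ ⟨⟨y⟩⟩ ⟨⟨z⟩⟩ a b
    obtain ⟨c, e, q, h⟩ := common x y a z b
    exact ⟨_, e, q, h⟩
  · rintro ⟨⟨x⟩⟩ ⟨⟨y⟩⟩ f hf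
    rcases eq_or_lt x y f with ⟨rfl, h⟩ | h
    · exact ⟨rfl, h⟩
    · rcases eq_or_lt y x (inv f) with ⟨rfl, -⟩ | h'
      · omega
      · omega

end OreOrder
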